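/- arXiv:2312.05350 — 8 statements merged into one kernel-verified Lean document; each statement's English description precedes it below -/
import Mathlib

section
/- Let X, U, Y, V be real intervals, D ⊆ X an interval, g : X → U and h : Y → V strictly monotone continuous bijections, and f : D → Y a function such that h∘f and g are differentiable on D with g' never zero on D. If the function (h∘f)'/g' is monotone on D and the number of strictly increasing functions among the three functions (h∘f)'/g', g, h is odd (1 or 3), then for every n ≥ 2, every x₁, …, xₙ ∈ D, and all positive weights p₁, …, pₙ summing to 1, f(g⁻¹(Σᵢ pᵢ·g(xᵢ))) ≤ h⁻¹(Σᵢ pᵢ·h(f(xᵢ))). If instead the number of strictly decreasing functions among (h∘f)'/g', g, h is odd, the reverse inequality f(g⁻¹(Σᵢ pᵢ·g(xᵢ))) ≥ h⁻¹(Σᵢ pᵢ·h(f(xᵢ))) holds. In both cases, if (h∘f)'/g' is strictly monotone, then equality holds only when x₁ = ⋯ = xₙ. -/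
open Set in
/-- Cauchy's mean value theorem in quotient form, for two points of an interval in either order. -/
lemma exists_strictly_between_sub_eq_ratio_mul {D : Set ℝ} (hD : D.OrdConnected)
    {g φ F G : ℝ → ℝ} (hF : ∀ x ∈ D, HasDerivAt φ (F x) x)
    (hG : ∀ x ∈ D, HasDerivAt g (G x) x) (hG0 : ∀ x ∈ D, G x ≠ 0)
    {m x : ℝ} (hm : m ∈ D) (hx : x ∈ D) (hne : x ≠ m) :
    ∃ c ∈ D, (m < c ∧ c < x ∨ x < c ∧ c < m) ∧ φ x - φ m = F c / G c * (g x - g m) := by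
  have key : ∀ a ∈ D, ∀ b ∈ D, a < b →
      ∃ c ∈ D, a < c ∧ c < b ∧ φ b - φ a = F c / G c * (g b - g a) := by
    intro a ha b hb hab
    have hsub : Icc a b ⊆ D := hD.out ha hb
    obtain ⟨c, hc, e⟩ := exists_ratio_hasDerivAt_eq_ratio_slope φ F hab
      (fun t ht => (hF t (hsub ht)).continuousAt.continuousWithinAt)
      (fun t ht => hF t (hsub (Ioo_subset_Icc_self ht))) g G
      (fun t ht => (hG t (hsub ht)).continuousAt.continuousWithinAt)
      (fun t ht => hG t (hsub (Ioo_subset_Icc_self ht)))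
    have hcD := hsub (Ioo_subset_Icc_self hc)
    refine ⟨c, hcD, hc.1, hc.2, ?_⟩
    have := hG0 c hcD
    field_simp
    linarith
  rcases lt_or_gt_of_ne hne with h | h
  · obtain ⟨c, hc, h1, h2, e⟩ := key x hx m hm h
    exact ⟨c, hc, Or.inr ⟨h1, h2⟩, by linarith⟩
  · obtain ⟨c, hc, h1, h2, e⟩ := key m hm x hx h
    exact ⟨c, hc, Or.inl ⟨h1, h2⟩, e⟩

/-- If `φ' / g'` and `g` are monotone in the same sense, then `φ` lies above its
tangent in the variable `g` at any point, strictly so off that point when `φ' / g'` is injective. -/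
lemma ratio_mul_sub_le_sub {D : Set ℝ} (hD : D.OrdConnected)
    {g φ F G : ℝ → ℝ} (hF : ∀ x ∈ D, HasDerivAt φ (F x) x)
    (hG : ∀ x ∈ D, HasDerivAt g (G x) x) (hG0 : ∀ x ∈ D, G x ≠ 0)
    (hmon : (MonotoneOn (fun t => F t / G t) D ∧ StrictMonoOn g D) ∨
      (AntitoneOn (fun t => F t / G t) D ∧ StrictAntiOn g D))
    {m x : ℝ} (hm : m ∈ D) (hx : x ∈ D) :
    F m / G m * (g x - g m) ≤ φ x - φ m ∧
      (Set.InjOn (fun t => F t / G t) D → F m / G m * (g x - g m) = φ x - φ m → x = m) := by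
  rcases eq_or_ne x m with rfl | hne
  · simp
  obtain ⟨c, hc, hbt, e⟩ := exists_strictly_between_sub_eq_ratio_mul hD hF hG hG0 hm hx hne
  have hgne : g x - g m ≠ 0 := by
    rw [sub_ne_zero]
    rcases hmon with ⟨-, h⟩ | ⟨-, h⟩ <;> exact fun h' => hne (h.injOn hx hm h')
  have hcm : c ≠ m := by rcases hbt with h | h <;> grind
  have hnn : 0 ≤ (F c / G c - F m / G m) * (g x - g m) := by
    rcases hmon with ⟨hk, hg⟩ | ⟨hk, hg⟩ <;> rcases hbt with ⟨h1, h2⟩ | ⟨h1, h2⟩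
    · exact mul_nonneg (sub_nonneg.2 (hk hm hc h1.le))
        (sub_nonneg.2 (hg hm hx (h1.trans h2)).le)
    · exact mul_nonneg_of_nonpos_of_nonpos (sub_nonpos.2 (hk hc hm h2.le))
        (sub_nonpos.2 (hg hx hm (h1.trans h2)).le)
    · exact mul_nonneg_of_nonpos_of_nonpos (sub_nonpos.2 (hk hm hc h1.le))
        (sub_nonpos.2 (hg hm hx (h1.trans h2)).le)
    · exact mul_nonneg (sub_nonneg.2 (hk hc hm h2.le))
        (sub_nonneg.2 (hg hx hm (h1.trans h2)).le)
  refine ⟨by linarith, fun hinj h => ?_⟩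
  have h0 : F m / G m = F c / G c := mul_right_cancel₀ hgne (h.trans e)
  exact absurd (hinj hc hm h0.symm) hcm

/-- Jensen's inequality for a function that is convex relative to `g`, with its equality case. -/
lemma le_sum_mul_of_monotone_ratio {ι : Type*} [Fintype ι] {D : Set ℝ} (hD : D.OrdConnected)
    {g φ F G : ℝ → ℝ} (hF : ∀ x ∈ D, HasDerivAt φ (F x) x)
    (hG : ∀ x ∈ D, HasDerivAt g (G x) x) (hG0 : ∀ x ∈ D, G x ≠ 0)
    (hmon : (MonotoneOn (fun t => F t / G t) D ∧ StrictMonoOn g D) ∨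
      (AntitoneOn (fun t => F t / G t) D ∧ StrictAntiOn g D))
    {m : ℝ} (hm : m ∈ D) {x p : ι → ℝ} (hx : ∀ i, x i ∈ D) (hp : ∀ i, 0 < p i)
    (hp1 : ∑ i, p i = 1) (hgm : g m = ∑ i, p i * g (x i)) :
    φ m ≤ ∑ i, p i * φ (x i) ∧
      (Set.InjOn (fun t => F t / G t) D → φ m = ∑ i, p i * φ (x i) → ∀ i, x i = m) := by
  have ht := fun i => ratio_mul_sub_le_sub hD hF hG hG0 hmon hm (hx i)
  have hle : ∀ i ∈ Finset.univ, p i * (F m / G m * (g (x i) - g m)) ≤ p i * (φ (x i) - φ m) :=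
    fun i _ => mul_le_mul_of_nonneg_left (ht i).1 (hp i).le
  have hl : ∑ i, p i * (F m / G m * (g (x i) - g m)) = 0 := by
    have : ∀ i, p i * (F m / G m * (g (x i) - g m)) =
        F m / G m * (p i * g (x i)) - F m / G m * g m * p i := fun i => by ring
    simp_rw [this, Finset.sum_sub_distrib, ← Finset.mul_sum, hp1, ← hgm]
    ring
  have hr : ∑ i, p i * (φ (x i) - φ m) = ∑ i, p i * φ (x i) - φ m := by
    simp_rw [mul_sub, Finset.sum_sub_distrib, ← Finset.sum_mul, hp1, one_mul]
  refine ⟨?_, fun hinj he i => ?_⟩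
  · have := Finset.sum_le_sum hle
    linarith
  · have := (Finset.sum_eq_sum_iff_of_le hle).1 (by linarith) i (Finset.mem_univ i)
    exact (ht i).2 hinj (mul_left_cancel₀ (hp i).ne' this)

/-- Jensen's inequality for a function that is concave relative to `g`, with its equality case. -/
lemma sum_mul_le_of_antitone_ratio {ι : Type*} [Fintype ι] {D : Set ℝ} (hD : D.OrdConnected)
    {g φ F G : ℝ → ℝ} (hF : ∀ x ∈ D, HasDerivAt φ (F x) x)
    (hG : ∀ x ∈ D, HasDerivAt g (G x) x) (hG0 : ∀ x ∈ D, G x ≠ 0)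
    (hmon : (AntitoneOn (fun t => F t / G t) D ∧ StrictMonoOn g D) ∨
      (MonotoneOn (fun t => F t / G t) D ∧ StrictAntiOn g D))
    {m : ℝ} (hm : m ∈ D) {x p : ι → ℝ} (hx : ∀ i, x i ∈ D) (hp : ∀ i, 0 < p i)
    (hp1 : ∑ i, p i = 1) (hgm : g m = ∑ i, p i * g (x i)) :
    ∑ i, p i * φ (x i) ≤ φ m ∧
      (Set.InjOn (fun t => F t / G t) D → φ m = ∑ i, p i * φ (x i) → ∀ i, x i = m) := by
  have hk : (fun t => (-F) t / G t) = fun t => -(F t / G t) := by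
    ext t
    simp [neg_div]
  have key := le_sum_mul_of_monotone_ratio (φ := -φ) (F := -F) hD (fun t ht => (hF t ht).neg)
    hG hG0 (by
      rw [hk]
      exact hmon.imp (fun h => ⟨h.1.neg, h.2⟩) (fun h => ⟨h.1.neg, h.2⟩)) hm hx hp hp1 hgm
  rw [hk] at key
  simp only [Pi.neg_apply, mul_neg, Finset.sum_neg_distrib, neg_le_neg_iff, neg_inj] at key
  exact ⟨key.1, fun hinj => key.2 fun a ha b hb h => hinj ha hb (neg_injective h)⟩

/-- A weighted mean of values of `g` on an interval is itself a value of `g` on that interval. -/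
lemma exists_mem_eq_sum_mul {ι : Type*} [Fintype ι] {D : Set ℝ} (hD : D.OrdConnected)
    {g : ℝ → ℝ} (hg : ContinuousOn g D) {x p : ι → ℝ} (hx : ∀ i, x i ∈ D) (hp : ∀ i, 0 ≤ p i)
    (hp1 : ∑ i, p i = 1) : ∃ m ∈ D, g m = ∑ i, p i * g (x i) := by
  have hconv : Convex ℝ (g '' D) :=
    (hD.isPreconnected.image g hg).ordConnected.convex
  exact hconv.sum_mem (fun i _ => hp i) hp1 fun i _ => Set.mem_image_of_mem g (hx i)


/-- Differential criterion (sufficiency) for dual-variable-isomorphic convexity.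
With strictly monotone continuous bijections `g : X → U`, `h : Y → V`, an interval
`D ⊆ X`, a function `f : D → Y` with `h∘f` and `g` differentiable on `D` (`g' ≠ 0`),
and `(h∘f)'/g'` monotone on `D`: if the number of strictly increasing functions among
`(h∘f)'/g', g, h` is odd then `f (g⁻¹(∑ pᵢ g xᵢ)) ≤ h⁻¹(∑ pᵢ h (f xᵢ))`; if the number
of strictly decreasing ones is odd the inequality reverses; and in both cases, if
`(h∘f)'/g'` is strictly monotone, equality forces all the `xᵢ` to be equal. -/
theorem stmt_5 (X U Y V D : Set ℝ)
    (hX : X.OrdConnected) (hU : U.OrdConnected) (hY : Y.OrdConnected)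
    (hV : V.OrdConnected) (hDX : D ⊆ X) (hD : D.OrdConnected)
    (g h f F G : ℝ → ℝ)
    (hgB : Set.BijOn g X U) (hhB : Set.BijOn h Y V)
    (hgm : StrictMonoOn g X ∨ StrictAntiOn g X)
    (hhm : StrictMonoOn h Y ∨ StrictAntiOn h Y)
    (hgc : ContinuousOn g X) (hhc : ContinuousOn h Y)
    (hfY : ∀ x ∈ D, f x ∈ Y)
    (hF : ∀ x ∈ D, HasDerivAt (h ∘ f) (F x) x)
    (hG : ∀ x ∈ D, HasDerivAt g (G x) x)
    (hG0 : ∀ x ∈ D, G x ≠ 0) :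
    -- odd number (1 or 3) of increasing functions among (h∘f)'/g', g, h :
    -- f is DVI convex
    (((MonotoneOn (fun t => F t / G t) D ∧ StrictAntiOn g X ∧ StrictAntiOn h Y) ∨
      (AntitoneOn (fun t => F t / G t) D ∧ StrictMonoOn g X ∧ StrictAntiOn h Y) ∨
      (AntitoneOn (fun t => F t / G t) D ∧ StrictAntiOn g X ∧ StrictMonoOn h Y) ∨
      (MonotoneOn (fun t => F t / G t) D ∧ StrictMonoOn g X ∧ StrictMonoOn h Y)) →
      ∀ n : ℕ, 2 ≤ n → ∀ x : Fin n → ℝ, (∀ i, x i ∈ D) →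
        ∀ p : Fin n → ℝ, (∀ i, 0 < p i) → ∑ i, p i = 1 →
          f (Function.invFunOn g X (∑ i, p i * g (x i))) ≤
            Function.invFunOn h Y (∑ i, p i * h (f (x i))) ∧
          ((StrictMonoOn (fun t => F t / G t) D ∨ StrictAntiOn (fun t => F t / G t) D) →
            f (Function.invFunOn g X (∑ i, p i * g (x i))) =
              Function.invFunOn h Y (∑ i, p i * h (f (x i))) →
            ∀ i j, x i = x j)) ∧
    -- odd number (1 or 3) of decreasing functions among (h∘f)'/g', g, h :
    -- f is DVI concave
    (((AntitoneOn (fun t => F t / G t) D ∧ StrictMonoOn g X ∧ StrictMonoOn h Y) ∨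
      (MonotoneOn (fun t => F t / G t) D ∧ StrictAntiOn g X ∧ StrictMonoOn h Y) ∨
      (MonotoneOn (fun t => F t / G t) D ∧ StrictMonoOn g X ∧ StrictAntiOn h Y) ∨
      (AntitoneOn (fun t => F t / G t) D ∧ StrictAntiOn g X ∧ StrictAntiOn h Y)) →
      ∀ n : ℕ, 2 ≤ n → ∀ x : Fin n → ℝ, (∀ i, x i ∈ D) →
        ∀ p : Fin n → ℝ, (∀ i, 0 < p i) → ∑ i, p i = 1 →
          f (Function.invFunOn g X (∑ i, p i * g (x i))) ≥
            Function.invFunOn h Y (∑ i, p i * h (f (x i))) ∧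
          ((StrictMonoOn (fun t => F t / G t) D ∨ StrictAntiOn (fun t => F t / G t) D) →
            f (Function.invFunOn g X (∑ i, p i * g (x i))) =
              Function.invFunOn h Y (∑ i, p i * h (f (x i))) →
            ∀ i j, x i = x j)) := by
  have mean : ∀ n : ℕ, ∀ x : Fin n → ℝ, (∀ i, x i ∈ D) →
      ∀ p : Fin n → ℝ, (∀ i, 0 < p i) → ∑ i, p i = 1 →
      ∃ m ∈ D, g m = ∑ i, p i * g (x i) ∧ Function.invFunOn g X (∑ i, p i * g (x i)) = m ∧
        ∃ y ∈ Y, h y = ∑ i, p i * h (f (x i)) ∧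
          Function.invFunOn h Y (∑ i, p i * h (f (x i))) = y := by
    intro n x hx p hp hp1
    obtain ⟨m, hm, hgm⟩ := exists_mem_eq_sum_mul hD (hgc.mono hDX) hx (fun i => (hp i).le) hp1
    obtain ⟨y, hy, hhy⟩ :=
      exists_mem_eq_sum_mul hY hhc (fun i => hfY _ (hx i)) (fun i => (hp i).le) hp1
    exact ⟨m, hm, hgm, hgm ▸ hgB.injOn.leftInvOn_invFunOn (hDX hm),
      y, hy, hhy, hhy ▸ hhB.injOn.leftInvOn_invFunOn hy⟩
  have inj : (StrictMonoOn (fun t => F t / G t) D ∨ StrictAntiOn (fun t => F t / G t) D) →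
      Set.InjOn (fun t => F t / G t) D := fun h => h.elim (·.injOn) (·.injOn)
  constructor
  · intro hcase n _ x hx p hp hp1
    obtain ⟨m, hm, hgm, em, y, hy, hhy, ey⟩ := mean n x hx p hp hp1
    rw [em, ey]
    have convex := fun hmon => le_sum_mul_of_monotone_ratio hD hF hG hG0 hmon hm hx hp hp1 hgm
    have concave := fun hmon => sum_mul_le_of_antitone_ratio hD hF hG hG0 hmon hm hx hp hp1 hgm
    simp only [Function.comp_apply, ← hhy] at convex concave
    have all_eq : (∀ i, x i = m) → ∀ i j, x i = x j := fun h i j => (h i).trans (h j).symm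
    rcases hcase with ⟨hk, hg, hh⟩ | ⟨hk, hg, hh⟩ | ⟨hk, hg, hh⟩ | ⟨hk, hg, hh⟩
    · have := concave (Or.inr ⟨hk, hg.mono hDX⟩)
      exact ⟨(hh.le_iff_ge hy (hfY m hm)).1 this.1,
        fun hs he => all_eq (this.2 (inj hs) (congrArg h he))⟩
    · have := concave (Or.inl ⟨hk, hg.mono hDX⟩)
      exact ⟨(hh.le_iff_ge hy (hfY m hm)).1 this.1,
        fun hs he => all_eq (this.2 (inj hs) (congrArg h he))⟩
    · have := convex (Or.inr ⟨hk, hg.mono hDX⟩)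
      exact ⟨(hh.le_iff_le (hfY m hm) hy).1 this.1,
        fun hs he => all_eq (this.2 (inj hs) (congrArg h he))⟩
    · have := convex (Or.inl ⟨hk, hg.mono hDX⟩)
      exact ⟨(hh.le_iff_le (hfY m hm) hy).1 this.1,
        fun hs he => all_eq (this.2 (inj hs) (congrArg h he))⟩
  · intro hcase n _ x hx p hp hp1
    obtain ⟨m, hm, hgm, em, y, hy, hhy, ey⟩ := mean n x hx p hp hp1
    rw [em, ey]
    have convex := fun hmon => le_sum_mul_of_monotone_ratio hD hF hG hG0 hmon hm hx hp hp1 hgm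
    have concave := fun hmon => sum_mul_le_of_antitone_ratio hD hF hG hG0 hmon hm hx hp hp1 hgm
    simp only [Function.comp_apply, ← hhy] at convex concave
    have all_eq : (∀ i, x i = m) → ∀ i j, x i = x j := fun h i j => (h i).trans (h j).symm
    rcases hcase with ⟨hk, hg, hh⟩ | ⟨hk, hg, hh⟩ | ⟨hk, hg, hh⟩ | ⟨hk, hg, hh⟩
    · have := concave (Or.inl ⟨hk, hg.mono hDX⟩)
      exact ⟨(hh.le_iff_le hy (hfY m hm)).1 this.1,
        fun hs he => all_eq (this.2 (inj hs) (congrArg h he))⟩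
    · have := concave (Or.inr ⟨hk, hg.mono hDX⟩)
      exact ⟨(hh.le_iff_le hy (hfY m hm)).1 this.1,
        fun hs he => all_eq (this.2 (inj hs) (congrArg h he))⟩
    · have := convex (Or.inl ⟨hk, hg.mono hDX⟩)
      exact ⟨(hh.le_iff_ge (hfY m hm) hy).1 this.1,
        fun hs he => all_eq (this.2 (inj hs) (congrArg h he))⟩
    · have := convex (Or.inr ⟨hk, hg.mono hDX⟩)
      exact ⟨(hh.le_iff_ge (hfY m hm) hy).1 this.1,
        fun hs he => all_eq (this.2 (inj hs) (congrArg h he))⟩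
end

section
/- Let X, U, Y, V be real intervals, D ⊆ X an interval, g : X → U and h : Y → V strictly monotone continuous bijections, and f : D → Y a function such that h∘f and g are differentiable on D with g' never zero on D. If the function (h∘f)'/g' is constant on D, then for every n ≥ 2, every x₁, …, xₙ ∈ D, and all positive weights p₁, …, pₙ summing to 1, f(g⁻¹(Σᵢ pᵢ·g(xᵢ))) = h⁻¹(Σᵢ pᵢ·h(f(xᵢ))). -/
/-- A function with zero derivative at every point of an interval is constant on it. -/
theorem Set.OrdConnected.eq_of_hasDerivAt_zero {D : Set ℝ} (hD : D.OrdConnected) {u : ℝ → ℝ}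
    (hu : ∀ x ∈ D, HasDerivAt u 0 x) {x y : ℝ} (hx : x ∈ D) (hy : y ∈ D) : u x = u y := by
  have key := hD.convex.norm_image_sub_le_of_norm_hasDerivWithin_le (C := 0)
    (fun z hz => (hu z hz).hasDerivWithinAt) (fun _ _ => norm_zero.le) hy hx
  rwa [zero_mul, norm_le_zero_iff, sub_eq_zero] at key

/-- A weighted mean of values of a continuous function on an interval is again such a value. -/
theorem Set.OrdConnected.sum_mul_mem_image {ι : Type*} [Fintype ι] {D : Set ℝ}
    (hD : D.OrdConnected) {g : ℝ → ℝ} (hg : ContinuousOn g D) {x p : ι → ℝ}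
    (hx : ∀ i, x i ∈ D) (hp : ∀ i, 0 ≤ p i) (hsum : ∑ i, p i = 1) :
    ∑ i, p i * g (x i) ∈ g '' D :=
  (hD.isPreconnected.image g hg).ordConnected.convex.sum_mem
    (fun i _ => hp i) hsum (fun i _ => Set.mem_image_of_mem g (hx i))

/-- Differential criterion, equality case: if `(h∘f)'/g'` is constant on `D`, then for
all tuples in `D` and positive weights summing to `1`,
`f (g⁻¹(∑ pᵢ g xᵢ)) = h⁻¹(∑ pᵢ h (f xᵢ))`. -/
theorem stmt_6 (X U Y V D : Set ℝ)
    (hX : X.OrdConnected) (hU : U.OrdConnected) (hY : Y.OrdConnected)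
    (hV : V.OrdConnected) (hDX : D ⊆ X) (hD : D.OrdConnected)
    (g h f F G : ℝ → ℝ)
    (hgB : Set.BijOn g X U) (hhB : Set.BijOn h Y V)
    (hgm : StrictMonoOn g X ∨ StrictAntiOn g X)
    (hhm : StrictMonoOn h Y ∨ StrictAntiOn h Y)
    (hgc : ContinuousOn g X) (hhc : ContinuousOn h Y)
    (hfY : ∀ x ∈ D, f x ∈ Y)
    (hF : ∀ x ∈ D, HasDerivAt (h ∘ f) (F x) x)
    (hG : ∀ x ∈ D, HasDerivAt g (G x) x)
    (hG0 : ∀ x ∈ D, G x ≠ 0)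
    (hconst : ∃ c : ℝ, ∀ x ∈ D, F x / G x = c) :
    ∀ n : ℕ, 2 ≤ n → ∀ x : Fin n → ℝ, (∀ i, x i ∈ D) →
      ∀ p : Fin n → ℝ, (∀ i, 0 < p i) → ∑ i, p i = 1 →
        f (Function.invFunOn g X (∑ i, p i * g (x i))) =
          Function.invFunOn h Y (∑ i, p i * h (f (x i))) := by
  intro n _ x hx p hp hsum
  obtain ⟨c, hc⟩ := hconst
  have hderiv : ∀ z ∈ D, HasDerivAt (fun y => h (f y) - c * g y) 0 z := by
    intro z hz
    have hFz : F z = c * G z := (div_eq_iff (hG0 z hz)).1 (hc z hz)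
    have hd := (hF z hz).sub ((hG z hz).const_mul c)
    rwa [hFz, sub_self] at hd
  obtain ⟨t, ht, hgt⟩ := hD.sum_mul_mem_image (hgc.mono hDX) hx (fun i => (hp i).le) hsum
  have hht : ∑ i, p i * h (f (x i)) = h (f t) := by
    have hi : ∀ i, h (f (x i)) = c * g (x i) + (h (f t) - c * g t) := fun i => by
      linarith [hD.eq_of_hasDerivAt_zero hderiv (hx i) ht]
    calc ∑ i, p i * h (f (x i))
        = ∑ i, (c * (p i * g (x i)) + p i * (h (f t) - c * g t)) :=
          Finset.sum_congr rfl fun i _ => by rw [hi i]; ring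
      _ = h (f t) := by
          rw [Finset.sum_add_distrib, ← Finset.mul_sum, ← Finset.sum_mul, hsum, ← hgt]
          ring
  rw [hht, ← hgt, hgB.injOn.leftInvOn_invFunOn (hDX ht),
    hhB.injOn.leftInvOn_invFunOn (hfY t ht)]
end

section
/- Let X, U, Y, V be real intervals, D ⊆ X an interval, g : X → U and h : Y → V strictly monotone continuous bijections, and f : D → Y a function such that h∘f and g are differentiable on D with g' never zero on D. Suppose f is a dual-variable-isomorphic convex function generated by g, h on D, i.e. f(g⁻¹(λ₁g(x₁)+λ₂g(x₂))) ≤ h⁻¹(λ₁h(f(x₁))+λ₂h(f(x₂))) for all x₁, x₂ ∈ D and λ₁, λ₂ ∈ (0,1) with λ₁+λ₂ = 1. If g and h are both increasing or both decreasing, then (h∘f)'/g' is increasing (nondecreasing) on D; if one of g, h is increasing and the other decreasing, then (h∘f)'/g' is decreasing (nonincreasing) on D. -/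
open Filter Topology

/-- `H` is convex as a function of `g` on `D`. -/
def ConvexAlong (g H : ℝ → ℝ) (D : Set ℝ) : Prop :=
  ∀ a ∈ D, ∀ b ∈ D, ∀ c ∈ D, ∀ l₁ l₂ : ℝ, 0 < l₁ → 0 < l₂ → l₁ + l₂ = 1 →
    g b = l₁ * g a + l₂ * g c → H b ≤ l₁ * H a + l₂ * H c

theorem tendsto_sub_div_sub {g H : ℝ → ℝ} {g' H' a : ℝ} (hH : HasDerivAt H H' a)
    (hg : HasDerivAt g g' a) (hg' : g' ≠ 0) :
    Tendsto (fun b => (H b - H a) / (g b - g a)) (𝓝[≠] a) (𝓝 (H' / g')) := by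
  refine ((hasDerivAt_iff_tendsto_slope.mp hH).div
    (hasDerivAt_iff_tendsto_slope.mp hg) hg').congr' ?_
  filter_upwards [self_mem_nhdsWithin] with b hb
  have hba : b - a ≠ 0 := sub_ne_zero.mpr hb
  simp only [Pi.div_apply, slope_def_field]
  exact div_div_div_cancel_right₀ hba _ _

theorem ConvexAlong.monotoneOn_div {g H G F : ℝ → ℝ} {D : Set ℝ} (h : ConvexAlong g H D)
    (hD : D.OrdConnected) (hg : StrictMonoOn g D) (hH : ∀ x ∈ D, HasDerivAt H (F x) x)
    (hG : ∀ x ∈ D, HasDerivAt g (G x) x) (hG0 : ∀ x ∈ D, G x ≠ 0) :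
    MonotoneOn (fun t => F t / G t) D := by
  intro a ha c hc hac
  rcases hac.eq_or_lt with rfl | hac
  · exact le_rfl
  have hgac := hg ha hc hac
  have chord : ∀ b ∈ Set.Ioo a c, g a < g b ∧ g b < g c ∧
      (H b - H a) * (g c - g a) ≤ (H c - H a) * (g b - g a) := by
    intro b ⟨hlt_left, hlt_right⟩
    have hbD : b ∈ D := hD.out ha hc ⟨hlt_left.le, hlt_right.le⟩
    have hab := hg ha hbD hlt_left
    have hbc := hg hbD hc hlt_right
    have hpos : 0 < g c - g a := sub_pos.mpr hgac
    have key := h a ha b hbD c hc ((g c - g b) / (g c - g a)) ((g b - g a) / (g c - g a))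
      (div_pos (by linarith) hpos) (div_pos (by linarith) hpos)
      (by field_simp; ring) (by field_simp; ring)
    have key' : H b * (g c - g a) ≤ (g c - g b) * H a + (g b - g a) * H c := by
      rw [← le_div_iff₀ hpos]
      exact key.trans_eq (by ring)
    exact ⟨hab, hbc, by linarith⟩
  trans (H c - H a) / (g c - g a)
  · refine le_of_tendsto ((tendsto_sub_div_sub (hH a ha) (hG a ha) (hG0 a ha)).mono_left
      (nhdsGT_le_nhdsNE a)) ?_
    filter_upwards [Ioo_mem_nhdsGT hac] with b hb
    obtain ⟨hab, hbc, key⟩ := chord b hb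
    rw [div_le_div_iff₀ (by linarith) (by linarith)]
    exact key
  · refine ge_of_tendsto ((tendsto_sub_div_sub (hH c hc) (hG c hc) (hG0 c hc)).mono_left
      (nhdsLT_le_nhdsNE c)) ?_
    filter_upwards [Ioo_mem_nhdsLT hac] with b hb
    obtain ⟨hab, hbc, key⟩ := chord b hb
    rw [← neg_div_neg_eq (H b - H c), div_le_div_iff₀ (by linarith) (by linarith)]
    linarith

theorem ConvexAlong.antitoneOn_div {g H G F : ℝ → ℝ} {D : Set ℝ} (h : ConvexAlong g H D)
    (hD : D.OrdConnected) (hg : StrictAntiOn g D) (hH : ∀ x ∈ D, HasDerivAt H (F x) x)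
    (hG : ∀ x ∈ D, HasDerivAt g (G x) x) (hG0 : ∀ x ∈ D, G x ≠ 0) :
    AntitoneOn (fun t => F t / G t) D := by
  have hneg : ConvexAlong (-g) H D := fun a ha b hb c hc l₁ l₂ h₁ h₂ hl hgb =>
    h a ha b hb c hc l₁ l₂ h₁ h₂ hl (by simp only [Pi.neg_apply] at hgb; linarith)
  have hmono := hneg.monotoneOn_div (G := -G) hD hg.neg hH (fun x hx => (hG x hx).neg)
    (fun x hx => neg_ne_zero.mpr (hG0 x hx))
  simpa [div_neg] using hmono.neg


/-- Differential criterion, necessity: if `f` is a dual-variable-isomorphic convex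
function generated by `g, h` on `D`, then `(h∘f)'/g'` is increasing on `D` when `g, h`
are both increasing or both decreasing, and decreasing on `D` when one of `g, h` is
increasing and the other decreasing. -/
theorem stmt_7 (X U Y V D : Set ℝ)
    (hX : X.OrdConnected) (hU : U.OrdConnected) (hY : Y.OrdConnected)
    (hV : V.OrdConnected) (hDX : D ⊆ X) (hD : D.OrdConnected)
    (g h f F G : ℝ → ℝ)
    (hgB : Set.BijOn g X U) (hhB : Set.BijOn h Y V)
    (hgm : StrictMonoOn g X ∨ StrictAntiOn g X)
    (hhm : StrictMonoOn h Y ∨ StrictAntiOn h Y)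
    (hgc : ContinuousOn g X) (hhc : ContinuousOn h Y)
    (hfY : ∀ x ∈ D, f x ∈ Y)
    (hF : ∀ x ∈ D, HasDerivAt (h ∘ f) (F x) x)
    (hG : ∀ x ∈ D, HasDerivAt g (G x) x)
    (hG0 : ∀ x ∈ D, G x ≠ 0)
    -- f is a dual-variable-isomorphic convex function generated by g, h on D
    (hDVI : ∀ x₁ ∈ D, ∀ x₂ ∈ D, ∀ l₁ l₂ : ℝ, 0 < l₁ → l₁ < 1 → 0 < l₂ → l₂ < 1 →
      l₁ + l₂ = 1 →
      f (Function.invFunOn g X (l₁ * g x₁ + l₂ * g x₂)) ≤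
        Function.invFunOn h Y (l₁ * h (f x₁) + l₂ * h (f x₂))) :
    (((StrictMonoOn g X ∧ StrictMonoOn h Y) ∨ (StrictAntiOn g X ∧ StrictAntiOn h Y)) →
      MonotoneOn (fun t => F t / G t) D) ∧
    (((StrictMonoOn g X ∧ StrictAntiOn h Y) ∨ (StrictAntiOn g X ∧ StrictMonoOn h Y)) →
      AntitoneOn (fun t => F t / G t) D) := by
  have comb : ∀ a ∈ D, ∀ b ∈ D, ∀ c ∈ D, ∀ l₁ l₂ : ℝ, 0 < l₁ → 0 < l₂ → l₁ + l₂ = 1 →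
      g b = l₁ * g a + l₂ * g c →
      ∃ y ∈ Y, h y = l₁ * h (f a) + l₂ * h (f c) ∧ f b ≤ y := by
    intro a ha b hb c hc l₁ l₂ h₁ h₂ hl hgb
    have hmem : l₁ * h (f a) + l₂ * h (f c) ∈ h '' Y := by
      rw [hhB.image_eq]
      exact hV.convex (hhB.mapsTo (hfY a ha)) (hhB.mapsTo (hfY c hc)) h₁.le h₂.le hl
    refine ⟨_, Function.invFunOn_mem hmem, Function.invFunOn_eq hmem, ?_⟩
    have key := hDVI a ha c hc l₁ l₂ h₁ (by linarith) h₂ (by linarith) hl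
    rwa [← hgb, hgB.injOn.leftInvOn_invFunOn (hDX hb)] at key
  have convex_of_mono (hm : StrictMonoOn h Y) : ConvexAlong g (h ∘ f) D := by
    intro a ha b hb c hc l₁ l₂ h₁ h₂ hl hgb
    obtain ⟨y, hy, hhy, hfy⟩ := comb a ha b hb c hc l₁ l₂ h₁ h₂ hl hgb
    exact (hm.monotoneOn (hfY b hb) hy hfy).trans_eq hhy
  have convex_neg_of_anti (hm : StrictAntiOn h Y) : ConvexAlong g (-(h ∘ f)) D := by
    intro a ha b hb c hc l₁ l₂ h₁ h₂ hl hgb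
    obtain ⟨y, hy, hhy, hfy⟩ := comb a ha b hb c hc l₁ l₂ h₁ h₂ hl hgb
    have := hm.antitoneOn (hfY b hb) hy hfy
    simp only [Pi.neg_apply, Function.comp_apply]
    linarith
  have hF_neg : ∀ x ∈ D, HasDerivAt (-(h ∘ f)) ((-F) x) x := fun x hx => (hF x hx).neg
  constructor
  · rintro (⟨hg, hh⟩ | ⟨hg, hh⟩)
    · exact (convex_of_mono hh).monotoneOn_div hD (hg.mono hDX) hF hG hG0
    · simpa [neg_div] using
        ((convex_neg_of_anti hh).antitoneOn_div hD (hg.mono hDX) hF_neg hG hG0).neg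
  · rintro (⟨hg, hh⟩ | ⟨hg, hh⟩)
    · simpa [neg_div] using
        ((convex_neg_of_anti hh).monotoneOn_div hD (hg.mono hDX) hF_neg hG hG0).neg
    · exact (convex_of_mono hh).antitoneOn_div hD (hg.mono hDX) hF hG hG0
end

section
/- Let n ≥ 2, let x₁, …, xₙ be positive reals, and let p₁, …, pₙ be positive weights summing to 1. Let s > 0 be the unique positive real with sinh s = Σᵢ pᵢ·sinh xᵢ and let t > 0 be the unique positive real with cosh t = Σᵢ pᵢ·cosh xᵢ. Then s ≤ t; that is, the isomorphic weighted mean of x₁,…,xₙ generated by sinh is at most the isomorphic weighted mean generated by cosh (restricted to the positive reals). -/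
/-- The isomorphic weighted mean generated by `sinh` is at most the one generated by
`cosh` on the positive reals: if `sinh s = ∑ pᵢ sinh xᵢ` and `cosh t = ∑ pᵢ cosh xᵢ`
with `s, t > 0`, positive `xᵢ`, and positive weights summing to `1`, then `s ≤ t`. -/
theorem stmt_10 (n : ℕ) (hn : 2 ≤ n) (x : Fin n → ℝ) (hx : ∀ i, 0 < x i)
    (p : Fin n → ℝ) (hp : ∀ i, 0 < p i) (hps : ∑ i, p i = 1)
    (s t : ℝ) (hs : 0 < s) (ht : 0 < t)
    (hsinh : Real.sinh s = ∑ i, p i * Real.sinh (x i))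
    (hcosh : Real.cosh t = ∑ i, p i * Real.cosh (x i)) :
    s ≤ t := by
  have tangent : 1 ≤ Real.cosh t * Real.cosh s - Real.sinh s * Real.sinh s := by
    calc (1 : ℝ) = ∑ i, p i * 1 := by simp [hps]
      _ ≤ ∑ i, p i * Real.cosh (x i - s) :=
        Finset.sum_le_sum fun i _ => mul_le_mul_of_nonneg_left (Real.one_le_cosh _) (hp i).le
      _ = (∑ i, p i * Real.cosh (x i)) * Real.cosh s
          - (∑ i, p i * Real.sinh (x i)) * Real.sinh s := by
        simp only [Real.cosh_sub, Finset.sum_mul, ← Finset.sum_sub_distrib]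
        exact Finset.sum_congr rfl fun i _ => by ring
      _ = Real.cosh t * Real.cosh s - Real.sinh s * Real.sinh s := by rw [← hcosh, ← hsinh]
  have cosh_le : Real.cosh s ≤ Real.cosh t := by
    refine le_of_mul_le_mul_right ?_ (Real.cosh_pos s)
    linarith [Real.cosh_sq s, sq (Real.cosh s), sq (Real.sinh s)]
  simpa [abs_of_pos hs, abs_of_pos ht] using Real.cosh_le_cosh.mp cosh_le
end

section
/- Let f be a differentiable real function on an open real interval I such that the function x ↦ x·f'(x) is increasing on I. Then for every n ≥ 2 and all positive reals x₁, …, xₙ with xᵢⁿ ∈ I for each i (so that also ∏ᵢ xᵢ ∈ I), n·f(∏ᵢ xᵢ) ≤ Σᵢ f(xᵢⁿ). Conversely, if x ↦ x·f'(x) is decreasing on I, the inequality reverses: n·f(∏ᵢ xᵢ) ≥ Σᵢ f(xᵢⁿ). -/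
/-- If `t ↦ t * f' t` is monotone on an open interval, where `f'` is the derivative of `f`, then
`f ∘ exp` is convex on the preimage of that interval. -/
theorem convexOn_comp_exp_of_monotoneOn_mul_deriv {I : Set ℝ} (hIo : IsOpen I)
    (hI : I.OrdConnected) {f f' : ℝ → ℝ} (hf : ∀ x ∈ I, HasDerivAt f (f' x) x)
    (hmono : MonotoneOn (fun t => t * f' t) I) :
    ConvexOn ℝ (Real.exp ⁻¹' I) (fun t => f (Real.exp t)) := by
  have hderiv : ∀ t ∈ Real.exp ⁻¹' I,
      HasDerivAt (fun t => f (Real.exp t)) (f' (Real.exp t) * Real.exp t) t :=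
    fun t ht => (hf _ ht).comp t (Real.hasDerivAt_exp t)
  refine MonotoneOn.convexOn_of_deriv (hI.preimage_mono Real.exp_monotone).convex
    (fun t ht => (hderiv t ht).continuousAt.continuousWithinAt) ?_ ?_
  · rw [(hIo.preimage Real.continuous_exp).interior_eq]
    exact fun t ht => (hderiv t ht).differentiableAt.differentiableWithinAt
  · rw [(hIo.preimage Real.continuous_exp).interior_eq]
    intro s hs t ht hst
    rw [(hderiv s hs).deriv, (hderiv t ht).deriv, mul_comm, mul_comm (f' (Real.exp t))]
    exact hmono hs ht (Real.exp_le_exp.mpr hst)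

/-- Jensen's inequality for `f ∘ exp`, written in terms of `n`-th powers and a product. -/
theorem ConvexOn.mul_map_prod_le_sum_map_pow {I : Set ℝ} {f : ℝ → ℝ}
    (hconv : ConvexOn ℝ (Real.exp ⁻¹' I) (fun t => f (Real.exp t))) {n : ℕ} (hn : n ≠ 0)
    {x : Fin n → ℝ} (hx : ∀ i, 0 < x i) (hxI : ∀ i, x i ^ n ∈ I) :
    (n : ℝ) * f (∏ i, x i) ≤ ∑ i, f (x i ^ n) := by
  have hn' : (0 : ℝ) < n := by positivity
  have hexp : ∀ i, Real.exp (n * Real.log (x i)) = x i ^ n := fun i => by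
    rw [Real.exp_nat_mul, Real.exp_log (hx i)]
  have hJ := hconv.map_sum_le (t := Finset.univ) (w := fun _ : Fin n => (n : ℝ)⁻¹)
    (p := fun i => n * Real.log (x i)) (fun _ _ => by positivity)
    (by simp [hn'.ne']) (fun i _ => by simpa only [Set.mem_preimage, hexp i] using hxI i)
  simp only [smul_eq_mul, inv_mul_cancel_left₀ hn'.ne', hexp, Real.exp_sum,
    Real.exp_log (hx _), ← Finset.mul_sum] at hJ
  exact (le_inv_mul_iff₀ hn').mp hJ

/-- Building inequalities from the differential criterion: if `f` is differentiable on
an open interval `I ⊆ (0,∞)` and `x ↦ x·f'(x)` is increasing on `I`, then for positive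
`x₁, …, xₙ` (`n ≥ 2`) with `xᵢⁿ ∈ I`, `n·f(∏ xᵢ) ≤ ∑ f(xᵢⁿ)`; if `x ↦ x·f'(x)` is
decreasing on `I`, the inequality reverses. -/
theorem stmt_11 (I : Set ℝ) (hIo : IsOpen I) (hI : I.OrdConnected)
    (hIpos : I ⊆ Set.Ioi (0 : ℝ))
    (f f' : ℝ → ℝ) (hf : ∀ x ∈ I, HasDerivAt f (f' x) x)
    (n : ℕ) (hn : 2 ≤ n) (x : Fin n → ℝ) (hx : ∀ i, 0 < x i)
    (hxI : ∀ i, x i ^ n ∈ I) :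
    (MonotoneOn (fun t => t * f' t) I →
      (n : ℝ) * f (∏ i, x i) ≤ ∑ i, f (x i ^ n)) ∧
    (AntitoneOn (fun t => t * f' t) I →
      (n : ℝ) * f (∏ i, x i) ≥ ∑ i, f (x i ^ n)) := by
  have hn0 : n ≠ 0 := by omega
  refine ⟨fun hmono => (convexOn_comp_exp_of_monotoneOn_mul_deriv hIo hI hf
    hmono).mul_map_prod_le_sum_map_pow hn0 hx hxI, fun hanti => ?_⟩
  have hmono : MonotoneOn (fun t => t * -f' t) I := by
    simpa only [mul_neg] using hanti.neg
  have h := ConvexOn.mul_map_prod_le_sum_map_pow (f := fun t => -f t)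
    (convexOn_comp_exp_of_monotoneOn_mul_deriv hIo hI (f := fun t => -f t)
      (fun t ht => (hf t ht).neg) hmono) hn0 hx hxI
  simpa only [mul_neg, Finset.sum_neg_distrib, neg_le_neg_iff] using h
end

section
/- Let a < b, let f : [a,b] → ℝ be bounded with M = inf f and S = sup f over [a,b], let g be strictly monotone and continuous on [a,b], and let h be strictly monotone and continuous on [M, S]. Suppose the function u ↦ h(f(g⁻¹(u))) is integrable on the interval with endpoints g(a), g(b), and let Mφ = (1/(g(b) − g(a)))·∫_{g(a)}^{g(b)} h(f(g⁻¹(u))) du. Then Mφ lies in the image h([M, S]), and the value h⁻¹(Mφ) (with h⁻¹ the inverse of h restricted to [M, S]) satisfies M ≤ h⁻¹(Mφ) ≤ S. -/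
open Set Function

/-- The average over an interval of a function with values in a closed convex set lies in
that set. -/
theorem intervalAverage_mem_of_isClosed_convex {F : ℝ → ℝ} {c d : ℝ} {K : Set ℝ} (hcd : c ≠ d)
    (hK : Convex ℝ K) (hKc : IsClosed K) (hF : ∀ u ∈ uIcc c d, F u ∈ K)
    (hint : IntervalIntegrable F MeasureTheory.volume c d) :
    (d - c)⁻¹ * ∫ u in c..d, F u ∈ K := by
  have hvol : MeasureTheory.volume (uIoc c d) = ENNReal.ofReal |d - c| := by
    rw [Real.volume_uIoc]
  rw [← smul_eq_mul, ← interval_average_eq]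
  refine hK.set_average_mem hKc ?_ ?_ ?_ (intervalIntegrable_iff.mp hint)
  · rw [hvol]
    simpa [sub_eq_zero] using hcd.symm
  · rw [hvol]
    exact ENNReal.ofReal_ne_top
  · exact (MeasureTheory.ae_restrict_iff' measurableSet_uIoc).mpr
      (.of_forall fun u hu => hF u (uIoc_subset_uIcc hu))

/-- Intermediate value property of the dual-variable-isomorphic mean: with `f` bounded
on `[a,b]`, `M = inf f`, `S = sup f`, `g` strictly monotone continuous on `[a,b]`, `h`
strictly monotone continuous on `[M,S]`, and `h∘f∘g⁻¹` integrable between `g a` and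
`g b`, the average `Mφ` of `h∘f∘g⁻¹` lies in `h '' [M,S]` and `M ≤ h⁻¹(Mφ) ≤ S`. -/
theorem stmt_13 (a b : ℝ) (hab : a < b) (f g h : ℝ → ℝ)
    (hbddA : BddAbove (f '' Icc a b)) (hbddB : BddBelow (f '' Icc a b))
    (M S : ℝ) (hM : M = sInf (f '' Icc a b)) (hS : S = sSup (f '' Icc a b))
    (hgm : StrictMonoOn g (Icc a b) ∨ StrictAntiOn g (Icc a b))
    (hgc : ContinuousOn g (Icc a b))
    (hhm : StrictMonoOn h (Icc M S) ∨ StrictAntiOn h (Icc M S))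
    (hhc : ContinuousOn h (Icc M S))
    (hint : IntervalIntegrable (fun u => h (f (invFunOn g (Icc a b) u)))
      MeasureTheory.volume (g a) (g b))
    (Mφ : ℝ)
    (hMφ : Mφ = (g b - g a)⁻¹ * ∫ u in (g a)..(g b), h (f (invFunOn g (Icc a b) u))) :
    Mφ ∈ h '' Icc M S ∧
      M ≤ invFunOn h (Icc M S) Mφ ∧ invFunOn h (Icc M S) Mφ ≤ S := by
  have ha : a ∈ Icc a b := left_mem_Icc.mpr hab.le
  have hb : b ∈ Icc a b := right_mem_Icc.mpr hab.le
  have hg_ne : g a ≠ g b := by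
    rcases hgm with hg | hg
    · exact (hg ha hb hab).ne
    · exact (hg ha hb hab).ne'
  have hf : ∀ x ∈ Icc a b, f x ∈ Icc M S := fun x hx =>
    ⟨hM ▸ csInf_le hbddB (mem_image_of_mem f hx), hS ▸ le_csSup hbddA (mem_image_of_mem f hx)⟩
  have hsurj : uIcc (g a) (g b) ⊆ g '' Icc a b := by
    have := intermediate_value_uIcc (a := a) (b := b) (f := g)
    rw [uIcc_of_le hab.le] at this
    exact this hgc
  have hmem : Mφ ∈ h '' Icc M S := by
    rw [hMφ]
    exact intervalAverage_mem_of_isClosed_convex hg_ne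
      (isPreconnected_Icc.image h hhc).ordConnected.convex
      (isCompact_Icc.image_of_continuousOn hhc).isClosed
      (fun u hu => mem_image_of_mem h (hf _ (invFunOn_mem (hsurj hu)))) hint
  exact ⟨hmem, invFunOn_mem hmem⟩
end

section
/- Let a < b, let f, m : [a,b] → ℝ be bounded, let D₂ ⊆ [a,b] be an interval such that m(x) ≥ f(x) for all x ∈ D₂ and m(x) = f(x) for all x ∈ [a,b] \ D₂. Let g be strictly monotone and continuous on [a,b] and let h be strictly monotone and continuous on an interval containing the ranges of both f and m, and suppose both u ↦ h(f(g⁻¹(u))) and u ↦ h(m(g⁻¹(u))) are integrable on the interval with endpoints g(a), g(b). Then h⁻¹((1/(g(b)−g(a)))·∫_{g(a)}^{g(b)} h(m(g⁻¹(u))) du) ≥ h⁻¹((1/(g(b)−g(a)))·∫_{g(a)}^{g(b)} h(f(g⁻¹(u))) du). Moreover, if m(x) > f(x) for all x ∈ D₂ and D₂ is nondegenerate, the inequality is strict. -/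
open Set Function

open MeasureTheory in
/-- An order-connected set of reals contains the average over a nondegenerate interval of every
integrable function with values in it. -/
theorem Set.OrdConnected.interval_average_mem {S : Set ℝ} (hS : S.OrdConnected) {c d : ℝ}
    (hcd : c ≠ d) {φ : ℝ → ℝ} (hφ : IntervalIntegrable φ volume c d)
    (hmem : ∀ u ∈ uIoc c d, φ u ∈ S) : (⨍ u in c..d, φ u) ∈ S := by
  have h0 : volume (uIoc c d) ≠ 0 := by
    simpa [uIoc, Real.volume_Ioc] using fun h : d ≤ c => lt_of_le_of_ne h hcd.symm
  have h1 : volume (uIoc c d) ≠ ⊤ := by simp [uIoc, Real.volume_Ioc]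
  have hi : IntegrableOn φ (uIoc c d) volume := intervalIntegrable_iff.1 hφ
  obtain ⟨x, hx, hxle⟩ := exists_le_setAverage h0 h1 hi
  obtain ⟨y, hy, hley⟩ := exists_setAverage_le h0 h1 hi
  exact hS.out (hmem x hx) (hmem y hy) ⟨hxle, hley⟩

open MeasureTheory in
theorem interval_average_mono {c d : ℝ} (hcd : c ≠ d) {φ ψ : ℝ → ℝ}
    (hφ : IntervalIntegrable φ volume c d) (hψ : IntervalIntegrable ψ volume c d)
    (hle : ∀ u ∈ uIcc c d, φ u ≤ ψ u) : (⨍ u in c..d, φ u) ≤ ⨍ u in c..d, ψ u := by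
  wlog h : c < d generalizing c d
  · rw [interval_average_symm φ, interval_average_symm ψ]
    exact this hcd.symm hφ.symm hψ.symm (by rwa [uIcc_comm]) (lt_of_le_of_ne (not_lt.1 h) hcd.symm)
  rw [interval_average_eq, interval_average_eq]
  rw [uIcc_of_le h.le] at hle
  exact smul_le_smul_of_nonneg_left (intervalIntegral.integral_mono_on h.le hφ hψ hle)
    (inv_nonneg.2 (sub_nonneg.2 h.le))

open MeasureTheory in
theorem interval_average_lt_of_lt_on_Ioo {c d p q : ℝ} (hcd : c ≠ d) {φ ψ : ℝ → ℝ}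
    (hφ : IntervalIntegrable φ volume c d) (hψ : IntervalIntegrable ψ volume c d)
    (hle : ∀ u ∈ uIcc c d, φ u ≤ ψ u) (hpq : p < q) (hsub : Ioo p q ⊆ uIoc c d)
    (hlt : ∀ u ∈ Ioo p q, φ u < ψ u) : (⨍ u in c..d, φ u) < ⨍ u in c..d, ψ u := by
  wlog h : c < d generalizing c d
  · rw [interval_average_symm φ, interval_average_symm ψ]
    exact this hcd.symm hφ.symm hψ.symm (by rwa [uIcc_comm]) (by rwa [uIoc_comm])
      (lt_of_le_of_ne (not_lt.1 h) hcd.symm)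
  rw [interval_average_eq, interval_average_eq]
  rw [uIcc_of_le h.le] at hle
  rw [uIoc_of_le h.le] at hsub
  refine smul_lt_smul_of_pos_left ?_ (inv_pos.2 (sub_pos.2 h))
  refine intervalIntegral.integral_lt_integral_of_ae_le_of_measure_setOfPred_lt_ne_zero h.le hφ hψ
    ((ae_restrict_mem measurableSet_Ioc).mono fun u hu => hle u (Ioc_subset_Icc_self hu)) ?_
  have hpos : 0 < (volume.restrict (Ioc c d)) (Ioo p q) := by
    rw [Measure.restrict_apply measurableSet_Ioo, inter_eq_left.2 hsub]
    simpa using hpq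
  exact (hpos.trans_le (measure_mono hlt)).ne'

theorem StrictMonoOn.strictMonoOn_invFunOn {h : ℝ → ℝ} {Y : Set ℝ} (hh : StrictMonoOn h Y) :
    StrictMonoOn (invFunOn h Y) (h '' Y) := by
  rintro s hs t ht hst
  rwa [← hh.lt_iff_lt (invFunOn_mem hs) (invFunOn_mem ht), invFunOn_eq hs, invFunOn_eq ht]

theorem StrictAntiOn.strictAntiOn_invFunOn {h : ℝ → ℝ} {Y : Set ℝ} (hh : StrictAntiOn h Y) :
    StrictAntiOn (invFunOn h Y) (h '' Y) := by
  rintro s hs t ht hst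
  rwa [← hh.lt_iff_gt (invFunOn_mem hs) (invFunOn_mem ht), invFunOn_eq hs, invFunOn_eq ht]

/-- Monotonicity of the dual-variable-isomorphic mean: if `m ≥ f` on a subinterval
`D₂ ⊆ [a,b]` and `m = f` elsewhere on `[a,b]`, then the DVI mean of `m` generated by
`g, h` is at least that of `f`; the inequality is strict if `m > f` on `D₂` and `D₂` is
nondegenerate. -/
theorem stmt_14 (a b : ℝ) (hab : a < b) (f m g h : ℝ → ℝ)
    (hfbddA : BddAbove (f '' Icc a b)) (hfbddB : BddBelow (f '' Icc a b))
    (hmbddA : BddAbove (m '' Icc a b)) (hmbddB : BddBelow (m '' Icc a b))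
    (D₂ : Set ℝ) (hD₂ : D₂ ⊆ Icc a b) (hD₂int : D₂.OrdConnected)
    (hge : ∀ x ∈ D₂, f x ≤ m x)
    (heq : ∀ x ∈ Icc a b, x ∉ D₂ → m x = f x)
    (Y : Set ℝ) (hY : Y.OrdConnected)
    (hfY : ∀ x ∈ Icc a b, f x ∈ Y) (hmY : ∀ x ∈ Icc a b, m x ∈ Y)
    (hgm : StrictMonoOn g (Icc a b) ∨ StrictAntiOn g (Icc a b))
    (hgc : ContinuousOn g (Icc a b))
    (hhm : StrictMonoOn h Y ∨ StrictAntiOn h Y) (hhc : ContinuousOn h Y)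
    (hintf : IntervalIntegrable (fun u => h (f (invFunOn g (Icc a b) u)))
      MeasureTheory.volume (g a) (g b))
    (hintm : IntervalIntegrable (fun u => h (m (invFunOn g (Icc a b) u)))
      MeasureTheory.volume (g a) (g b)) :
    invFunOn h Y ((g b - g a)⁻¹ * ∫ u in (g a)..(g b), h (m (invFunOn g (Icc a b) u))) ≥
      invFunOn h Y ((g b - g a)⁻¹ * ∫ u in (g a)..(g b), h (f (invFunOn g (Icc a b) u))) ∧
    ((∀ x ∈ D₂, f x < m x) → (∃ u ∈ D₂, ∃ v ∈ D₂, u ≠ v) →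
      invFunOn h Y ((g b - g a)⁻¹ * ∫ u in (g a)..(g b), h (m (invFunOn g (Icc a b) u))) >
        invFunOn h Y ((g b - g a)⁻¹ * ∫ u in (g a)..(g b), h (f (invFunOn g (Icc a b) u)))) := by
  have hinj : InjOn g (Icc a b) := hgm.elim StrictMonoOn.injOn StrictAntiOn.injOn
  have hgab : g a ≠ g b := fun h' =>
    hab.ne (hinj (left_mem_Icc.2 hab.le) (right_mem_Icc.2 hab.le) h')
  have hinv : ∀ u ∈ uIcc (g a) (g b), invFunOn g (Icc a b) u ∈ Icc a b := fun u hu => by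
    have := intermediate_value_uIcc (by rwa [uIcc_of_le hab.le]) hu
    rw [uIcc_of_le hab.le] at this
    exact invFunOn_mem this
  have hfm : ∀ x ∈ Icc a b, f x ≤ m x := fun x hx => by
    by_cases hxD : x ∈ D₂
    · exact hge x hxD
    · exact (heq x hx hxD).ge
  have hS : (h '' Y).OrdConnected := (hY.isPreconnected.image h hhc).ordConnected
  have hfmem := hS.interval_average_mem hgab hintf fun u hu =>
    mem_image_of_mem h (hfY _ (hinv u (uIoc_subset_uIcc hu)))
  have hmmem := hS.interval_average_mem hgab hintm fun u hu =>
    mem_image_of_mem h (hmY _ (hinv u (uIoc_subset_uIcc hu)))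
  simp only [← smul_eq_mul, ← interval_average_eq]
  refine ⟨?_, fun hlt hnd => ?_⟩
  · rcases hhm with hh | hh
    · exact hh.strictMonoOn_invFunOn.monotoneOn hfmem hmmem <|
        interval_average_mono hgab hintf hintm fun u hu =>
          hh.monotoneOn (hfY _ (hinv u hu)) (hmY _ (hinv u hu)) (hfm _ (hinv u hu))
    · exact hh.strictAntiOn_invFunOn.antitoneOn hmmem hfmem <|
        interval_average_mono hgab hintm hintf fun u hu =>
          hh.antitoneOn (hfY _ (hinv u hu)) (hmY _ (hinv u hu)) (hfm _ (hinv u hu))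
  · obtain ⟨x, hx, y, hy, hxy⟩ := hnd
    have hpq : min (g x) (g y) < max (g x) (g y) :=
      min_lt_max.2 fun h' => hxy (hinj (hD₂ hx) (hD₂ hy) h')
    have hxyD : uIcc x y ⊆ D₂ := hD₂int.uIcc_subset hx hy
    have hD : ∀ u ∈ uIcc (g x) (g y), invFunOn g (Icc a b) u ∈ D₂ := fun u hu => by
      obtain ⟨z, hz, rfl⟩ := intermediate_value_uIcc (hgc.mono (hxyD.trans hD₂)) hu
      rw [hinj.leftInvOn_invFunOn (hD₂ (hxyD hz))]
      exact hxyD hz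
    have hg : ∀ z ∈ Icc a b, g z ∈ uIcc (g a) (g b) := fun z hz => by
      have ha := left_mem_Icc.2 hab.le
      have hb := right_mem_Icc.2 hab.le
      rcases hgm with hg | hg
      · exact mem_uIcc_of_le (hg.monotoneOn ha hz hz.1) (hg.monotoneOn hz hb hz.2)
      · exact mem_uIcc_of_ge (hg.antitoneOn hz hb hz.2) (hg.antitoneOn ha hz hz.1)
    have hsub : Ioo (min (g x) (g y)) (max (g x) (g y)) ⊆ uIoc (g a) (g b) := fun u hu =>
      ⟨(le_min (hg x (hD₂ hx)).1 (hg y (hD₂ hy)).1).trans_lt hu.1,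
        hu.2.le.trans (max_le (hg x (hD₂ hx)).2 (hg y (hD₂ hy)).2)⟩
    rcases hhm with hh | hh
    · exact hh.strictMonoOn_invFunOn hfmem hmmem <|
        interval_average_lt_of_lt_on_Ioo hgab hintf hintm (fun u hu =>
          hh.monotoneOn (hfY _ (hinv u hu)) (hmY _ (hinv u hu)) (hfm _ (hinv u hu))) hpq hsub
          fun u hu => by
            have hu' := hD u (Ioo_subset_Icc_self hu)
            exact hh (hfY _ (hD₂ hu')) (hmY _ (hD₂ hu')) (hlt _ hu')
    · exact hh.strictAntiOn_invFunOn hmmem hfmem <|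
        interval_average_lt_of_lt_on_Ioo hgab hintm hintf (fun u hu =>
          hh.antitoneOn (hfY _ (hinv u hu)) (hmY _ (hinv u hu)) (hfm _ (hinv u hu))) hpq hsub
          fun u hu => by
            have hu' := hD u (Ioo_subset_Icc_self hu)
            exact hh (hfY _ (hD₂ hu')) (hmY _ (hD₂ hu')) (hlt _ hu')
end

section
/- Let a < b and let f, g be strictly monotone, continuously differentiable real functions on [a,b]. Set A = f(a), B = f(b), C = g(a), D = g(b), E = (1/(D − C))·∫_a^b f(x)·g'(x) dx, F = (1/(B − A))·∫_a^b g(x)·f'(x) dx, G = (A + B)/2, H = (C + D)/2. Then: (1) (E − A)·(F − C) = (B − E)·(D − F), so that whenever E ∉ {A, B} and F ∉ {C, D} the product of ratios ((E−A)/(B−E))·((F−C)/(D−F)) equals 1; and (2) (E − G)/(B − A) = (H − F)/(D − C). -/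
open Set

theorem ne_endpoints_of_strictMonoOn_or_strictAntiOn {a b : ℝ} {f : ℝ → ℝ} (hab : a < b)
    (hf : StrictMonoOn f (Icc a b) ∨ StrictAntiOn f (Icc a b)) : f a ≠ f b := by
  have ha := left_mem_Icc.2 hab.le
  have hb := right_mem_Icc.2 hab.le
  rcases hf with hf | hf
  · exact (hf ha hb hab).ne
  · exact (hf ha hb hab).ne'

/-- Conjugation of two isomorphic means class II with exchanged original and generator
functions: with `A = f a`, `B = f b`, `C = g a`, `D = g b`,
`E = M_f|_g^{II}`, `F = M_g|_f^{II}`, `G = (A+B)/2`, `H = (C+D)/2`, one has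
`(E−A)(F−C) = (B−E)(D−F)` (i.e. `(AE:EB)·(CF:FD) = 1`) and
`(E−G)/(B−A) = (H−F)/(D−C)`. -/
theorem stmt_18 (a b : ℝ) (hab : a < b) (f g f' g' : ℝ → ℝ)
    (hfm : StrictMonoOn f (Icc a b) ∨ StrictAntiOn f (Icc a b))
    (hgm : StrictMonoOn g (Icc a b) ∨ StrictAntiOn g (Icc a b))
    (hf : ∀ x ∈ Icc a b, HasDerivWithinAt f (f' x) (Icc a b) x)
    (hg : ∀ x ∈ Icc a b, HasDerivWithinAt g (g' x) (Icc a b) x)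
    (hf'c : ContinuousOn f' (Icc a b)) (hg'c : ContinuousOn g' (Icc a b))
    (A B C D E F G H : ℝ)
    (hA : A = f a) (hB : B = f b) (hC : C = g a) (hD : D = g b)
    (hE : E = (D - C)⁻¹ * ∫ x in a..b, f x * g' x)
    (hF : F = (B - A)⁻¹ * ∫ x in a..b, g x * f' x)
    (hG : G = (A + B) / 2) (hH : H = (C + D) / 2) :
    ((E - A) * (F - C) = (B - E) * (D - F) ∧
      (E ≠ A → E ≠ B → F ≠ C → F ≠ D →
        ((E - A) / (B - E)) * ((F - C) / (D - F)) = 1)) ∧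
    (E - G) / (B - A) = (H - F) / (D - C) := by
  have hBA : B - A ≠ 0 := by
    rw [hA, hB]
    exact sub_ne_zero.2 (ne_endpoints_of_strictMonoOn_or_strictAntiOn hab hfm).symm
  have hDC : D - C ≠ 0 := by
    rw [hC, hD]
    exact sub_ne_zero.2 (ne_endpoints_of_strictMonoOn_or_strictAntiOn hab hgm).symm
  have hparts : ∫ x in a..b, f x * g' x = B * D - A * C - ∫ x in a..b, g x * f' x := by
    simp only [mul_comm (g _)]
    rw [hA, hB, hC, hD]
    rw [← uIcc_of_le hab.le] at hf hg hf'c hg'c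
    exact intervalIntegral.integral_mul_deriv_eq_deriv_mul_of_hasDerivWithinAt hf hg
      hf'c.intervalIntegrable hg'c.intervalIntegrable
  have hE' : (D - C) * E = ∫ x in a..b, f x * g' x := by rw [hE, mul_inv_cancel_left₀ hDC]
  have hF' : (B - A) * F = ∫ x in a..b, g x * f' x := by rw [hF, mul_inv_cancel_left₀ hBA]
  have hprod : (E - A) * (F - C) = (B - E) * (D - F) := by
    linear_combination hE' + hF' + hparts
  refine ⟨⟨hprod, fun _ hEB _ hFD ↦ ?_⟩, ?_⟩
  · have h₁ := sub_ne_zero.2 hEB.symm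
    have h₂ := sub_ne_zero.2 hFD.symm
    rw [div_mul_div_comm, hprod, div_self (mul_ne_zero h₁ h₂)]
  · rw [div_eq_div_iff hBA hDC, hG, hH]
    linear_combination hprod
end
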